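/- Let K ≥ 2 and W be a smooth function supported in [1,2] with W^{(j)} ≪_j 1. For real x with 0 < x ≤ K^{2−ε} for some ε > 0, the sum ∑_{k odd} W((k−1)/K)·i^{−k}·J_{k−1}(x) is O_A(K·x^{−A}·K^{−A}) for every A ≥ 1, i.e. negligibly small; in particular it is ≪_{A,ε} K^{−A}. -/

import Mathlib

/-- Bessel function of the first kind of integer order, via the integral representation. -/
noncomputable def besselJ (n : ℤ) (x : ℝ) : ℝ :=
  (1 / Real.pi) * ∫ θ in (0:ℝ)..Real.pi, Real.cos (n * θ - x * Real.sin θ)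

/-- The `M`-fold forward difference of step `h` is at most `h ^ M` times a bound for the `M`-th
derivative. -/
theorem abs_fwdDiff_iter_le {h D : ℝ} (hh : 0 ≤ h) (M : ℕ) (f : ℝ → ℝ)
    (hf : ContDiff ℝ (⊤ : ℕ∞) f) (hD : ∀ y, |iteratedDeriv M f y| ≤ D) (y : ℝ) :
    |(fwdDiff h)^[M] f y| ≤ h ^ M * D := by
  induction M generalizing f D with
  | zero => simpa using hD y
  | succ M ih =>
    rw [Function.iterate_succ_apply]
    have hshift : ContDiff ℝ (⊤ : ℕ∞) (fun z => f (z + h)) :=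
      hf.comp (contDiff_id.add contDiff_const)
    have hstep : ∀ y, |iteratedDeriv M (fwdDiff h f) y| ≤ D * h := by
      intro y
      have h1 : iteratedDeriv M (fwdDiff h f) y =
          iteratedDeriv M f (y + h) - iteratedDeriv M f y := by
        change iteratedDeriv M (fun z => f (z + h) - f z) y = _
        rw [iteratedDeriv_fun_sub (hshift.contDiffAt.of_le (by exact_mod_cast le_top))
          (hf.contDiffAt.of_le (by exact_mod_cast le_top)), iteratedDeriv_comp_add_const]
      rw [h1]
      have h2 := Convex.norm_image_sub_le_of_norm_deriv_le (𝕜 := ℝ) (f := iteratedDeriv M f)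
        (s := Set.univ) (x := y) (y := y + h) (C := D)
        (fun x _ => (hf.differentiable_iteratedDeriv M (by exact_mod_cast WithTop.coe_lt_top _)) x)
        (fun x _ => by rw [← iteratedDeriv_succ]; exact hD x) convex_univ trivial trivial
      simpa [abs_of_nonneg hh] using h2
    have := ih (fwdDiff h f) (hshift.sub hf) hstep
    calc _ ≤ _ := this
      _ = _ := by ring

theorem fwdDiff_iter_comp_mul_intCast (h : ℝ) (M : ℕ) (f : ℝ → ℝ) (m : ℤ) :
    (fwdDiff (1 : ℤ))^[M] (fun m : ℤ => ((f (h * m) : ℝ) : ℂ)) m = (((fwdDiff h)^[M] f (h * m) : ℝ) : ℂ) := by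
  induction M generalizing f with
  | zero => simp
  | succ M ih =>
    have hstep : fwdDiff (1 : ℤ) (fun m : ℤ => ((f (h * m) : ℝ) : ℂ)) =
        fun m : ℤ => ((fwdDiff h f (h * m) : ℝ) : ℂ) := by
      ext m
      simp [fwdDiff, mul_add]
    rw [Function.iterate_succ_apply, Function.iterate_succ_apply, hstep, ih]

/-- Repeated summation by parts for a finitely supported trigonometric sum. -/
theorem norm_sub_one_pow_mul_norm_tsum_le {z : ℂ} (hz : ‖z‖ = 1) {B : ℝ} (M : ℕ) (w : ℤ → ℂ)
    (a b : ℤ) (hw : ∀ m, m ∉ Finset.Icc a b → w m = 0)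
    (hB : ∀ m, ‖(fwdDiff (1 : ℤ))^[M] w m‖ ≤ B) :
    ‖z⁻¹ - 1‖ ^ M * ‖∑' m : ℤ, w m * z ^ m‖ ≤ (Finset.Icc (a - M) b).card * B := by
  induction M generalizing w a with
  | zero =>
    rw [tsum_eq_sum (s := Finset.Icc a b) (fun m hm => by simp [hw m hm])]
    simp only [pow_zero, one_mul, Nat.cast_zero, sub_zero]
    rw [← nsmul_eq_mul]
    refine (norm_sum_le _ _).trans (Finset.sum_le_card_nsmul _ _ _ fun m _ => ?_)
    simpa [hz] using hB m
  | succ M ih =>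
    have hz0 : z ≠ 0 := by rintro rfl; simp at hz
    have hw' : ∀ m, m ∉ Finset.Icc (a - 1) b → fwdDiff (1 : ℤ) w m = 0 := by
      intro m hm
      simp only [Finset.mem_Icc, not_and_or, not_le] at hm hw
      rw [fwdDiff, hw m (by omega), hw (m + 1) (by omega), sub_zero]
    have hs : Summable fun m : ℤ => w m * z ^ m :=
      summable_of_ne_finset_zero (s := Finset.Icc a b) (fun m hm => by simp [hw m hm])
    have hshift : (fun m : ℤ => w (m + 1) * z ^ m) =
        fun m : ℤ => z⁻¹ * (fun k : ℤ => w k * z ^ k) (Equiv.addRight (1 : ℤ) m) := by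
      ext m
      simp only [Equiv.coe_addRight, zpow_add_one₀ hz0]
      field_simp
    have hs' : Summable fun m : ℤ => w (m + 1) * z ^ m := by
      rw [hshift]
      exact ((Equiv.addRight (1 : ℤ)).summable_iff.mpr hs).mul_left _
    have key : ∑' m : ℤ, fwdDiff (1 : ℤ) w m * z ^ m = (z⁻¹ - 1) * ∑' m : ℤ, w m * z ^ m := by
      simp only [fwdDiff, sub_mul]
      rw [hs'.tsum_sub hs, hshift, tsum_mul_left,
        (Equiv.addRight (1 : ℤ)).tsum_eq (fun k : ℤ => w k * z ^ k), one_mul]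
    have := ih (fwdDiff (1 : ℤ) w) (a - 1) hw' (fun m => by
      rw [← Function.iterate_succ_apply]; exact hB m)
    rw [key, norm_mul, ← mul_assoc, ← pow_succ] at this
    convert this using 4
    push_cast
    ring_nf

/-- `sin² θ` powers of degree below `m` are orthogonal to `e^{2imθ}`. -/
theorem integral_exp_mul_sin_sq_pow_eq_zero (j : ℕ) (m : ℤ) (hm : (j : ℤ) < m) :
    ∫ θ in (-(Real.pi / 2))..(Real.pi / 2),
      Complex.exp (2 * θ * Complex.I) ^ m * ((Real.sin θ ^ 2 : ℝ) : ℂ) ^ j = 0 := by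
  induction j generalizing m with
  | zero =>
    have hm' : (m : ℂ) ≠ 0 := by
      have : m ≠ 0 := by push_cast at hm; omega
      exact_mod_cast this
    have hc : (m * (2 * Complex.I) : ℂ) ≠ 0 := by simp [hm']
    have h1 : ∀ θ : ℝ, Complex.exp (2 * θ * Complex.I) ^ m * ((Real.sin θ ^ 2 : ℝ) : ℂ) ^ 0 =
        Complex.exp (m * (2 * Complex.I) * θ) := by
      intro θ
      rw [← Complex.exp_int_mul, pow_zero, mul_one]
      ring_nf
    simp only [h1]
    rw [integral_exp_mul_complex hc]
    have h2 : Complex.exp (m * (2 * Complex.I) * ((Real.pi / 2 : ℝ) : ℂ)) =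
        Complex.exp (m * (2 * Complex.I) * ((-(Real.pi / 2) : ℝ) : ℂ)) := by
      rw [Complex.exp_eq_exp_iff_exists_int]
      refine ⟨m, ?_⟩
      push_cast
      ring
    rw [h2, sub_self, zero_div]
  | succ j ih =>
    have hsin : ∀ θ : ℝ, ((Real.sin θ ^ 2 : ℝ) : ℂ) =
        1 / 2 - (Complex.exp (2 * θ * Complex.I) + (Complex.exp (2 * θ * Complex.I))⁻¹) / 4 := by
      intro θ
      have h1 := Complex.two_cos (2 * (θ : ℂ))
      rw [← Complex.exp_neg]
      push_cast
      rw [Complex.sin_sq, Complex.cos_sq]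
      rw [neg_mul] at h1
      linear_combination (-1 / 4 : ℂ) * h1
    have hexp : ∀ θ : ℝ,
        Complex.exp (2 * θ * Complex.I) ^ m * ((Real.sin θ ^ 2 : ℝ) : ℂ) ^ (j + 1) =
        1 / 2 * (Complex.exp (2 * θ * Complex.I) ^ m * ((Real.sin θ ^ 2 : ℝ) : ℂ) ^ j) -
        (1 / 4 * (Complex.exp (2 * θ * Complex.I) ^ (m + 1) * ((Real.sin θ ^ 2 : ℝ) : ℂ) ^ j) +
        1 / 4 * (Complex.exp (2 * θ * Complex.I) ^ (m - 1) * ((Real.sin θ ^ 2 : ℝ) : ℂ) ^ j)) := by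
      intro θ
      rw [pow_succ, zpow_add_one₀ (Complex.exp_ne_zero _), zpow_sub_one₀ (Complex.exp_ne_zero _)]
      generalize ((Real.sin θ ^ 2 : ℝ) : ℂ) ^ j = s
      rw [hsin]
      ring
    have hcont : ∀ k : ℤ, IntervalIntegrable (fun θ : ℝ =>
        Complex.exp (2 * θ * Complex.I) ^ k * ((Real.sin θ ^ 2 : ℝ) : ℂ) ^ j)
        MeasureTheory.volume (-(Real.pi / 2)) (Real.pi / 2) := by
      intro k
      apply Continuous.intervalIntegrable
      simp only [← Complex.exp_int_mul]
      fun_prop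
    push_cast at hm
    simp only [hexp]
    rw [intervalIntegral.integral_sub ((hcont _).const_mul _)
        (((hcont _).const_mul _).add ((hcont _).const_mul _)),
      intervalIntegral.integral_add ((hcont _).const_mul _) ((hcont _).const_mul _)]
    simp only [intervalIntegral.integral_const_mul]
    rw [ih m (by omega), ih (m + 1) (by omega), ih (m - 1) (by omega)]
    simp

theorem integral_exp_mul_eval_sin_sq_eq_zero (P : Polynomial ℝ) (m : ℤ) (hm : (P.natDegree : ℤ) < m) :
    ∫ θ in (-(Real.pi / 2))..(Real.pi / 2),
      Complex.exp (2 * θ * Complex.I) ^ m * ((P.eval (Real.sin θ ^ 2) : ℝ) : ℂ) = 0 := by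
  have h1 : ∀ θ : ℝ, Complex.exp (2 * θ * Complex.I) ^ m * ((P.eval (Real.sin θ ^ 2) : ℝ) : ℂ) =
      ∑ j ∈ Finset.range (P.natDegree + 1), (P.coeff j : ℂ) *
        (Complex.exp (2 * θ * Complex.I) ^ m * ((Real.sin θ ^ 2 : ℝ) : ℂ) ^ j) := by
    intro θ
    rw [Polynomial.eval_eq_sum_range]
    push_cast
    rw [Finset.mul_sum]
    exact Finset.sum_congr rfl fun j _ => by ring
  simp only [h1]
  rw [intervalIntegral.integral_finsetSum]
  · refine Finset.sum_eq_zero fun j hj => ?_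
    rw [intervalIntegral.integral_const_mul, integral_exp_mul_sin_sq_pow_eq_zero j m, mul_zero]
    have := Finset.mem_range.mp hj
    omega
  · intro j _
    apply Continuous.intervalIntegrable
    simp only [← Complex.exp_int_mul]
    fun_prop

/-- On `[0, 1]`, `c` is `1 - R (1 - c²)` up to `(1 - c²) ^ n` for some polynomial `R`. -/
theorem exists_polynomial_sqrt_approx (n : ℕ) :
    ∃ R : Polynomial ℝ, ∀ c : ℝ, 0 ≤ c → c ≤ 1 →
      0 ≤ R.eval (1 - c ^ 2) ∧ R.eval (1 - c ^ 2) ≤ 1 - c ^ 2 ∧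
      |c - (1 - R.eval (1 - c ^ 2))| ≤ (1 - c ^ 2) ^ (n + 1) := by
  induction n with
  | zero =>
    refine ⟨0, fun c h0 h1 => ?_⟩
    have : 0 ≤ 1 - c ^ 2 := by nlinarith
    simp only [Polynomial.eval_zero, zero_add, pow_one, sub_zero]
    refine ⟨le_rfl, this, ?_⟩
    rw [abs_le]
    constructor <;> nlinarith
  | succ n ih =>
    obtain ⟨R, hR⟩ := ih
    refine ⟨Polynomial.C (1 / 2) * (Polynomial.X + R ^ 2), fun c h0 h1 => ?_⟩
    obtain ⟨hr0, hr1, hr2⟩ := hR c h0 h1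
    have ht0 : 0 ≤ 1 - c ^ 2 := by nlinarith
    simp only [Polynomial.eval_mul, Polynomial.eval_C, Polynomial.eval_add, Polynomial.eval_X,
      Polynomial.eval_pow]
    set r := R.eval (1 - c ^ 2)
    have hr3 : r ≤ 1 := by nlinarith
    refine ⟨by positivity, by nlinarith, ?_⟩
    have h2 : c - (1 - 1 / 2 * (1 - c ^ 2 + r ^ 2)) = (c - (1 - r)) * ((1 - c + r) / 2) := by ring
    rw [h2, abs_mul, pow_succ]
    have h3 : |(1 - c + r) / 2| ≤ 1 - c ^ 2 := by
      rw [abs_of_nonneg (by linarith)]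
      nlinarith
    gcongr

theorem norm_exp_I_mul_sub_sum_le (y : ℝ) (n : ℕ) :
    ‖Complex.exp (y * Complex.I) -
      ∑ j ∈ Finset.range n, ((y : ℂ) * Complex.I) ^ j / (j.factorial : ℂ)‖ ≤ 4 * |y| ^ n := by
  have hn : ‖(y : ℂ) * Complex.I‖ = |y| := by simp
  have he : Real.exp 1 ≤ 3 := Real.exp_one_lt_three.le
  rcases le_total |y| 1 with hy | hy
  · refine (Complex.norm_exp_sub_sum_le_norm_mul_exp _ n).trans ?_
    rw [hn, mul_comm]
    gcongr
    exact (Real.exp_le_exp.mpr hy).trans (by linarith)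
  · refine (norm_sub_le _ _).trans ?_
    rw [Complex.norm_exp_ofReal_mul_I]
    have h1 : (1 : ℝ) ≤ |y| ^ n := one_le_pow₀ hy
    have h2 : ‖∑ j ∈ Finset.range n, ((y : ℂ) * Complex.I) ^ j / (j.factorial : ℂ)‖ ≤
        |y| ^ n * 3 := by
      calc _ ≤ ∑ j ∈ Finset.range n, |y| ^ n * (1 ^ j / (j.factorial : ℝ)) := by
            refine norm_sum_le_of_le _ fun j hj => ?_
            rw [norm_div, norm_pow, hn, Complex.norm_natCast, one_pow, mul_one_div]
            gcongr
            · exact (Finset.mem_range.mp hj).le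
        _ = |y| ^ n * ∑ j ∈ Finset.range n, (1 ^ j / (j.factorial : ℝ)) := by
            rw [Finset.mul_sum]
        _ ≤ _ := by
            gcongr
            exact (Real.sum_le_exp_of_nonneg zero_le_one n).trans he
    linarith

/-- Approximation of `e^{-ixc}` for `c = √(1 - t)` by powers of a polynomial in `t`. -/
theorem norm_exp_sub_exp_mul_sum_le {c x r : ℝ} {n : ℕ} (hn : n ≠ 0) (hx : 0 ≤ x)
    (hc : c ^ 2 ≤ 1) (hr0 : 0 ≤ r) (hr1 : r ≤ 1 - c ^ 2)
    (hr2 : |c - (1 - r)| ≤ (1 - c ^ 2) ^ n) :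
    ‖Complex.exp (-(x * c : ℝ) * Complex.I) - Complex.exp (-x * Complex.I) *
      ∑ j ∈ Finset.range n, (((x * r : ℝ) : ℂ) * Complex.I) ^ j / (j.factorial : ℂ)‖ ≤
      5 * (1 + x) ^ n * (1 - c ^ 2) ^ n := by
  have h1 := norm_exp_I_mul_sub_sum_le (x * r) n
  have hu : ‖Complex.exp (-x * Complex.I)‖ = 1 := by
    rw [← Complex.ofReal_neg, Complex.norm_exp_ofReal_mul_I]
  have e1 : Complex.exp (-(x * c : ℝ) * Complex.I) =
      Complex.exp (-x * Complex.I) * Complex.exp ((x * r : ℝ) * Complex.I) *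
        Complex.exp (Complex.I * ((-(x * (c - (1 - r)))) : ℝ)) := by
    rw [← Complex.exp_add, ← Complex.exp_add]
    congr 1
    push_cast
    ring
  set S := ∑ j ∈ Finset.range n, (((x * r : ℝ) : ℂ) * Complex.I) ^ j / (j.factorial : ℂ)
  set u := Complex.exp (-x * Complex.I)
  set v := Complex.exp ((x * r : ℝ) * Complex.I) with hv
  have hv1 : ‖v‖ = 1 := Complex.norm_exp_ofReal_mul_I _
  have e2 : ∀ q : ℂ, u * v * q - u * S = u * v * (q - 1) + u * (v - S) := fun q => by ring
  rw [e1, e2]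
  refine (norm_add_le _ _).trans ?_
  rw [norm_mul, norm_mul, norm_mul, hu, hv1, one_mul, one_mul, one_mul]
  have h2 := Real.norm_exp_I_mul_ofReal_sub_one_le (x := -(x * (c - (1 - r))))
  rw [norm_neg, norm_mul, Real.norm_of_nonneg hx, Real.norm_eq_abs] at h2
  rw [abs_of_nonneg (mul_nonneg hx hr0), mul_pow] at h1
  have ht : 0 ≤ 1 - c ^ 2 := by linarith
  have h3 : x ^ n ≤ (1 + x) ^ n := by gcongr; linarith
  have h4 : x ≤ (1 + x) ^ n := by
    calc x ≤ 1 + x := by linarith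
      _ ≤ (1 + x) ^ n := le_self_pow₀ (by linarith) hn
  have h5 : r ^ n ≤ (1 - c ^ 2) ^ n := by gcongr
  have h6 : x * |c - (1 - r)| ≤ (1 + x) ^ n * (1 - c ^ 2) ^ n := by gcongr
  have h7 : x ^ n * r ^ n ≤ (1 + x) ^ n * (1 - c ^ 2) ^ n := by gcongr
  linarith

/-- The even-order Bessel function, up to sign, as a cosine-phase Fourier coefficient. -/
theorem neg_one_pow_mul_besselJ_two_mul (m : ℕ) (x : ℝ) :
    (-1) ^ m * besselJ (2 * m) x = (1 / Real.pi) *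
      ∫ θ in (-(Real.pi / 2))..(Real.pi / 2), Real.cos (2 * m * θ - x * Real.cos θ) := by
  have h := intervalIntegral.integral_comp_add_right (a := -(Real.pi / 2)) (b := Real.pi / 2)
    (fun θ : ℝ => Real.cos (((2 * m : ℤ) : ℝ) * θ - x * Real.sin θ)) (Real.pi / 2)
  have e0 : -(Real.pi / 2) + Real.pi / 2 = 0 := by ring
  have e1 : Real.pi / 2 + Real.pi / 2 = Real.pi := by ring
  rw [e0, e1] at h
  rw [besselJ, ← h]
  have h2 : ∀ θ : ℝ, Real.cos (((2 * m : ℤ) : ℝ) * (θ + Real.pi / 2) -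
      x * Real.sin (θ + Real.pi / 2)) = (-1) ^ m * Real.cos (2 * m * θ - x * Real.cos θ) := by
    intro θ
    rw [Real.sin_add_pi_div_two, ← Real.cos_add_nat_mul_pi]
    congr 1
    push_cast
    ring
  simp only [h2]
  rw [intervalIntegral.integral_const_mul]
  have h3 : ((-1 : ℝ) ^ m) * (-1) ^ m = 1 := by rw [← mul_pow]; simp
  linear_combination (1 / Real.pi * ∫ θ in (-(Real.pi / 2))..(Real.pi / 2),
    Real.cos (2 * m * θ - x * Real.cos θ)) * h3

theorem abs_neg_one_pow_mul_besselJ_two_mul_le (m : ℕ) (x : ℝ) :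
    |(-1) ^ m * besselJ (2 * m) x| ≤ 1 := by
  have h := intervalIntegral.norm_integral_le_of_norm_le_const (a := -(Real.pi / 2))
    (b := Real.pi / 2) (C := 1) (f := fun θ : ℝ => Real.cos (2 * m * θ - x * Real.cos θ))
    (fun θ _ => Real.abs_cos_le_one _)
  have hpi := Real.pi_pos
  have e : |Real.pi / 2 - -(Real.pi / 2)| = Real.pi := by
    rw [abs_of_nonneg (by linarith)]; ring
  rw [e, one_mul, Real.norm_eq_abs] at h
  rw [neg_one_pow_mul_besselJ_two_mul, abs_mul, abs_of_pos (by positivity)]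
  calc _ ≤ 1 / Real.pi * Real.pi := by gcongr
    _ = 1 := by field_simp

theorem mem_Icc_of_apply_two_div_mul_ne_zero {K : ℝ} (hK : 0 < K) {W : ℝ → ℝ}
    (hW : Function.support W ⊆ Set.Icc 1 2) {y : ℝ} (hy : W (2 / K * y) ≠ 0) :
    y ∈ Set.Icc (K / 2) K := by
  obtain ⟨h1, h2⟩ := hW hy
  have e : 2 / K * y = 2 * y / K := by ring
  rw [e] at h1 h2
  rw [le_div_iff₀ hK] at h1
  rw [div_le_iff₀ hK] at h2
  constructor <;> linarith

/-- Concentration of the smoothed exponential sum near `θ ≡ 0 (mod π)`. -/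
theorem norm_sum_mul_sin_sq_pow_le (n : ℕ) {K D : ℝ} (hK : 2 ≤ K) {W : ℝ → ℝ}
    (hsm : ContDiff ℝ (⊤ : ℕ∞) W) (hW : Function.support W ⊆ Set.Icc 1 2)
    (hD : ∀ y, |iteratedDeriv (2 * n) W y| ≤ D) (θ : ℝ) :
    ‖∑ m ∈ Finset.range (⌊K⌋₊ + 1), (W (2 / K * m) : ℂ) *
      Complex.exp (2 * θ * Complex.I) ^ (m : ℤ)‖ * (Real.sin θ ^ 2) ^ n ≤
      (2 * n + 2) * K * ((1 / K) ^ (2 * n) * D) := by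
  have hK0 : 0 < K := by linarith
  have hD0 : 0 ≤ D := (abs_nonneg _).trans (hD 0)
  set z := Complex.exp (2 * θ * Complex.I) with hzdef
  have hz : ‖z‖ = 1 := by
    rw [hzdef]
    exact_mod_cast Complex.norm_exp_ofReal_mul_I (2 * θ)
  have hmem : ∀ m : ℤ, W (2 / K * m) ≠ 0 → 0 ≤ m ∧ m ≤ (⌊K⌋₊ : ℤ) := by
    intro m hm
    obtain ⟨h1, h2⟩ := mem_Icc_of_apply_two_div_mul_ne_zero hK0 hW hm
    have h3 : (0 : ℝ) < m := by linarith
    have h4 : 0 < m := by exact_mod_cast h3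
    refine ⟨h4.le, ?_⟩
    rw [Int.natCast_floor_eq_floor hK0.le]
    exact Int.le_floor.mpr h2
  have hsum : ∑ m ∈ Finset.range (⌊K⌋₊ + 1), (W (2 / K * m) : ℂ) * z ^ (m : ℤ) =
      ∑' m : ℤ, ((W (2 / K * m) : ℝ) : ℂ) * z ^ m := by
    rw [← (Nat.cast_injective (R := ℤ)).tsum_eq, tsum_eq_sum (s := Finset.range (⌊K⌋₊ + 1))]
    · simp
    · intro m hm
      by_contra h
      have h1 : W (2 / K * ((m : ℤ) : ℝ)) ≠ 0 := fun h0 => h (by rw [h0]; simp)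
      have := (hmem m h1).2
      exact hm (Finset.mem_range.mpr (by omega))
    · intro m hm
      have h1 : W (2 / K * (m : ℝ)) ≠ 0 := fun h0 => hm (by simp [h0])
      exact ⟨m.toNat, Int.toNat_of_nonneg (hmem m h1).1⟩
  have hparts := norm_sub_one_pow_mul_norm_tsum_le hz (B := (2 / K) ^ (2 * n) * D) (2 * n)
    (fun m : ℤ => ((W (2 / K * m) : ℝ) : ℂ)) 0 ⌊K⌋₊
    (fun m hm => by
      by_contra h
      have h1 : W (2 / K * (m : ℝ)) ≠ 0 := fun h0 => h (by simp [h0])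
      exact hm (Finset.mem_Icc.mpr (hmem m h1)))
    (fun m => by
      rw [fwdDiff_iter_comp_mul_intCast, Complex.norm_real]
      exact abs_fwdDiff_iter_le (by positivity) _ W hsm hD _)
  have hnorm : ‖z⁻¹ - 1‖ ^ (2 * n) = 4 ^ n * (Real.sin θ ^ 2) ^ n := by
    have e1 : z⁻¹ = Complex.exp (Complex.I * ((-(2 * θ) : ℝ) : ℂ)) := by
      rw [hzdef, ← Complex.exp_neg]
      congr 1
      push_cast
      ring
    have e2 : -(2 * θ) / 2 = -θ := by ring
    rw [e1, Complex.norm_exp_I_mul_ofReal_sub_one, e2, Real.sin_neg, pow_mul, Real.norm_eq_abs,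
      sq_abs, ← mul_pow]
    ring
  rw [hnorm, ← hsum] at hparts
  have hcard : ((Finset.Icc ((0 : ℤ) - (2 * n : ℕ)) ⌊K⌋₊).card : ℝ) ≤ (2 * n + 2) * K := by
    rw [Int.card_Icc]
    have e : ((⌊K⌋₊ : ℤ) + 1 - (0 - ((2 * n : ℕ) : ℤ))).toNat = ⌊K⌋₊ + 1 + 2 * n := by omega
    rw [e]
    push_cast
    have := Nat.floor_le hK0.le
    nlinarith [(Nat.cast_nonneg n : (0 : ℝ) ≤ n)]
  have hpow : (2 / K) ^ (2 * n) = 4 ^ n * (1 / K) ^ (2 * n) := by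
    rw [div_eq_mul_one_div, mul_pow, pow_mul 2]
    norm_num
  have h4 : (0 : ℝ) < 4 ^ n := by positivity
  refine le_of_mul_le_mul_left ?_ h4
  calc _ = 4 ^ n * (Real.sin θ ^ 2) ^ n * ‖∑ m ∈ Finset.range (⌊K⌋₊ + 1), (W (2 / K * m) : ℂ) *
            z ^ (m : ℤ)‖ := by ring
    _ ≤ _ := hparts
    _ ≤ (2 * n + 2) * K * ((2 / K) ^ (2 * n) * D) := by gcongr
    _ = _ := by rw [hpow]; ring

theorem abs_sum_mul_besselJ_le {n : ℕ} (hn : n ≠ 0) (R : Polynomial ℝ)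
    (hR : ∀ c : ℝ, 0 ≤ c → c ≤ 1 →
      0 ≤ R.eval (1 - c ^ 2) ∧ R.eval (1 - c ^ 2) ≤ 1 - c ^ 2 ∧
      |c - (1 - R.eval (1 - c ^ 2))| ≤ (1 - c ^ 2) ^ n)
    {K D : ℝ} (hK : 2 ≤ K) (hdeg : ((n * R.natDegree : ℕ) : ℝ) < K / 2) {W : ℝ → ℝ}
    (hsm : ContDiff ℝ (⊤ : ℕ∞) W) (hW : Function.support W ⊆ Set.Icc 1 2)
    (hD : ∀ y, |iteratedDeriv (2 * n) W y| ≤ D) {x : ℝ} (hx : 0 ≤ x) :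
    |∑ m ∈ Finset.range (⌊K⌋₊ + 1), W (2 / K * m) * ((-1) ^ m * besselJ (2 * m) x)| ≤
      5 * (1 + x) ^ n * ((2 * n + 2) * K * ((1 / K) ^ (2 * n) * D)) := by
  have hK0 : 0 < K := by linarith
  have hpi := Real.pi_pos
  set s := Finset.range (⌊K⌋₊ + 1)
  set E : ℝ → ℂ := fun θ => ∑ m ∈ s, (W (2 / K * m) : ℂ) *
      Complex.exp (2 * θ * Complex.I) ^ (m : ℤ) with hE
  set G : ℝ → ℂ := fun θ => Complex.exp (-(x * Real.cos θ : ℝ) * Complex.I) with hG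
  set P : ℝ → ℂ := fun θ => Complex.exp (-x * Complex.I) *
      ∑ j ∈ Finset.range n,
        (((x * R.eval (Real.sin θ ^ 2) : ℝ) : ℂ) * Complex.I) ^ j / (j.factorial : ℂ) with hP
  have hEc : Continuous E := by
    simp only [hE, ← Complex.exp_int_mul]
    fun_prop
  have hGc : Continuous G := by fun_prop
  have hRc : Continuous fun θ : ℝ => R.eval (Real.sin θ ^ 2) :=
    R.continuous.comp (Real.continuous_sin.pow 2)
  have hPc : Continuous P := by fun_prop
  have hEGc : Continuous fun θ => E θ * G θ := hEc.mul hGc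
  have hEPc : Continuous fun θ => E θ * P θ := hEc.mul hPc
  have horth : ∫ θ in (-(Real.pi / 2))..(Real.pi / 2), E θ * P θ = 0 := by
    have e1 : ∀ θ, E θ * P θ = ∑ m ∈ s, ∑ j ∈ Finset.range n,
        ((W (2 / K * m) : ℂ) * Complex.exp (-x * Complex.I) *
          ((x : ℂ) * Complex.I) ^ j / (j.factorial : ℂ)) *
        (Complex.exp (2 * θ * Complex.I) ^ (m : ℤ) *
          (((R ^ j).eval (Real.sin θ ^ 2) : ℝ) : ℂ)) := by
      intro θ
      simp only [hE, hP]
      rw [Finset.mul_sum, Finset.sum_mul_sum]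
      refine Finset.sum_congr rfl fun m _ => Finset.sum_congr rfl fun j _ => ?_
      rw [Polynomial.eval_pow]
      push_cast
      ring
    have hint : ∀ (m j : ℕ) (a : ℂ), Continuous fun θ : ℝ =>
        a * (Complex.exp (2 * θ * Complex.I) ^ (m : ℤ) *
          (((R ^ j).eval (Real.sin θ ^ 2) : ℝ) : ℂ)) := by
      intro m j a
      have := (R ^ j).continuous.comp (Real.continuous_sin.pow 2)
      simp only [Function.comp_def] at this
      simp only [← Complex.exp_int_mul]
      fun_prop
    simp only [e1]
    rw [intervalIntegral.integral_finsetSum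
      (fun m _ => (continuous_finsetSum _ fun j _ => hint m j _).intervalIntegrable _ _)]
    refine Finset.sum_eq_zero fun m _ => ?_
    rw [intervalIntegral.integral_finsetSum (fun j _ => (hint m j _).intervalIntegrable _ _)]
    refine Finset.sum_eq_zero fun j hj => ?_
    rw [intervalIntegral.integral_const_mul]
    by_cases hm : W (2 / K * m) = 0
    · simp [hm]
    · have h1 := (mem_Icc_of_apply_two_div_mul_ne_zero hK0 hW hm).1
      have h2 : n * R.natDegree < m := by exact_mod_cast hdeg.trans_le h1
      have h3 : (R ^ j).natDegree < m := by
        refine lt_of_le_of_lt (Polynomial.natDegree_pow_le.trans ?_) h2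
        exact Nat.mul_le_mul_right _ (Finset.mem_range.mp hj).le
      rw [integral_exp_mul_eval_sin_sq_eq_zero _ _ (by exact_mod_cast h3), mul_zero]
  have hre : ∑ m ∈ s, W (2 / K * m) * ((-1) ^ m * besselJ (2 * m) x) = (1 / Real.pi) *
      (∫ θ in (-(Real.pi / 2))..(Real.pi / 2), E θ * G θ).re := by
    have e1 : ∀ θ, (E θ * G θ).re =
        ∑ m ∈ s, W (2 / K * m) * Real.cos (2 * m * θ - x * Real.cos θ) := by
      intro θ
      simp only [hE, hG, Finset.sum_mul, Complex.re_sum]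
      refine Finset.sum_congr rfl fun m _ => ?_
      rw [← Complex.exp_int_mul, mul_assoc, ← Complex.exp_add, Complex.re_ofReal_mul,
        ← Complex.exp_ofReal_mul_I_re (2 * m * θ - x * Real.cos θ)]
      congr 3
      push_cast
      ring
    have e2 := Complex.reCLM.intervalIntegral_comp_comm
      (hEGc.intervalIntegrable (μ := MeasureTheory.volume) (-(Real.pi / 2)) (Real.pi / 2))
    simp only [Complex.reCLM_apply, e1] at e2
    rw [← e2, intervalIntegral.integral_finsetSum, Finset.mul_sum]
    · refine Finset.sum_congr rfl fun m _ => ?_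
      rw [neg_one_pow_mul_besselJ_two_mul, intervalIntegral.integral_const_mul]
      ring
    · intro m _
      apply Continuous.intervalIntegrable
      fun_prop
  have hdiff : ∫ θ in (-(Real.pi / 2))..(Real.pi / 2), E θ * G θ =
      ∫ θ in (-(Real.pi / 2))..(Real.pi / 2), E θ * (G θ - P θ) := by
    simp only [mul_sub]
    rw [intervalIntegral.integral_sub (hEGc.intervalIntegrable _ _)
      (hEPc.intervalIntegrable _ _), horth, sub_zero]
  have hbound : ∀ θ ∈ Set.uIoc (-(Real.pi / 2)) (Real.pi / 2), ‖E θ * (G θ - P θ)‖ ≤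
      5 * (1 + x) ^ n * ((2 * n + 2) * K * ((1 / K) ^ (2 * n) * D)) := by
    intro θ hθ
    rw [Set.uIoc_of_le (by linarith)] at hθ
    have hc0 : 0 ≤ Real.cos θ := Real.cos_nonneg_of_mem_Icc ⟨hθ.1.le, hθ.2⟩
    obtain ⟨h0, h1, h2⟩ := hR _ hc0 (Real.cos_le_one θ)
    have h3 := norm_exp_sub_exp_mul_sum_le hn hx (Real.cos_sq_le_one θ) h0 h1 h2
    have h4 := norm_sum_mul_sin_sq_pow_le n hK hsm hW hD θ
    rw [← Real.sin_sq] at h3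
    rw [norm_mul]
    calc _ ≤ ‖E θ‖ * (5 * (1 + x) ^ n * (Real.sin θ ^ 2) ^ n) := by gcongr
      _ = 5 * (1 + x) ^ n * (‖E θ‖ * (Real.sin θ ^ 2) ^ n) := by ring
      _ ≤ _ := by gcongr
  have hI := intervalIntegral.norm_integral_le_of_norm_le_const hbound
  have e : |Real.pi / 2 - -(Real.pi / 2)| = Real.pi := by
    rw [abs_of_nonneg (by linarith)]; ring
  rw [e] at hI
  rw [hre, hdiff, abs_mul, abs_of_pos (by positivity : 0 < 1 / Real.pi)]
  calc _ ≤ 1 / Real.pi * (5 * (1 + x) ^ n * ((2 * n + 2) * K * ((1 / K) ^ (2 * n) * D)) *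
        Real.pi) := by
        gcongr
        exact (Complex.abs_re_le_norm _).trans hI
    _ = _ := by field_simp

/-- The sum over odd `k` as a finite sum over `m = (k - 1) / 2`. -/
theorem norm_tsum_odd_eq {K : ℝ} (hK : 0 < K) {W : ℝ → ℝ}
    (hW : Function.support W ⊆ Set.Icc 1 2) (x : ℝ) :
    ‖∑' k : ℕ, (if Odd k then
        (W (((k:ℝ)-1)/K) : ℂ) * Complex.I ^ (-(k:ℤ)) * (besselJ ((k:ℤ)-1) x : ℝ)
      else 0)‖ =
    |∑ m ∈ Finset.range (⌊K⌋₊ + 1), W (2 / K * m) * ((-1) ^ m * besselJ (2 * m) x)| := by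
  have hinj : Function.Injective fun m : ℕ => 2 * m + 1 := fun a b h => by
    simp only at h
    omega
  rw [← hinj.tsum_eq]
  · have hterm : ∀ m : ℕ, (if Odd (2 * m + 1) then
        (W ((((2 * m + 1 : ℕ):ℝ)-1)/K) : ℂ) * Complex.I ^ (-((2 * m + 1 : ℕ):ℤ)) *
          (besselJ (((2 * m + 1 : ℕ):ℤ)-1) x : ℝ) else 0) =
        -Complex.I * ((W (2 / K * m) * ((-1) ^ m * besselJ (2 * m) x) : ℝ) : ℂ) := by
      intro m
      rw [if_pos (odd_two_mul_add_one m)]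
      have e1 : (((2 * m + 1 : ℕ):ℝ)-1)/K = 2 / K * m := by push_cast; ring
      have e2 : (((2 * m + 1 : ℕ):ℤ)-1) = 2 * m := by push_cast; ring
      have e3 : Complex.I ^ (-((2 * m + 1 : ℕ):ℤ)) = -Complex.I * (-1) ^ m := by
        rw [zpow_neg, zpow_natCast, pow_succ, pow_mul, Complex.I_sq, mul_inv, Complex.inv_I,
          ← inv_pow]
        norm_num
        ring
      rw [e1, e2, e3]
      push_cast
      ring
    simp only [hterm]
    rw [tsum_eq_sum (s := Finset.range (⌊K⌋₊ + 1)), ← Finset.mul_sum, norm_mul, norm_neg,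
      Complex.norm_I, one_mul, ← Complex.ofReal_sum, Complex.norm_real, Real.norm_eq_abs]
    intro m hm
    by_contra h
    have h1 : W (2 / K * m) ≠ 0 := fun h0 => h (by simp [h0])
    have := Nat.le_floor (mem_Icc_of_apply_two_div_mul_ne_zero hK hW h1).2
    exact hm (Finset.mem_range.mpr (by omega))
  · intro k hk
    rw [Function.mem_support] at hk
    have : Odd k := by
      by_contra h
      simp [h] at hk
    obtain ⟨m, rfl⟩ := this
    exact ⟨m, rfl⟩

/-- For `0 < x ≤ K^{2−ε}` the smoothed sum of Bessel functions
`∑_{k odd} W((k−1)/K)·i^{−k}·J_{k−1}(x)` is negligibly small, `≪_{A,ε} K^{−A}`. -/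
theorem stmt_12 (ε A : ℝ) (hε : 0 < ε) (hA : 1 ≤ A) (D : ℕ → ℝ) :
    ∃ C > 0, ∀ (K : ℝ), 2 ≤ K → ∀ (W : ℝ → ℝ), ContDiff ℝ (⊤ : ℕ∞) W →
      Function.support W ⊆ Set.Icc 1 2 →
      (∀ (j : ℕ) (y : ℝ), |iteratedDeriv j W y| ≤ D j) →
      ∀ x : ℝ, 0 < x → x ≤ K ^ (2 - ε) →
      ‖∑' k : ℕ, (if Odd k then
            (W (((k:ℝ)-1)/K) : ℂ) * Complex.I ^ (-(k:ℤ)) * (besselJ ((k:ℤ)-1) x : ℝ)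
          else 0)‖ ≤ C * K ^ (-A) := by
  set δ := min ε 2 with hδ
  have hδ0 : 0 < δ := lt_min hε two_pos
  have hδ2 : δ ≤ 2 := min_le_right _ _
  obtain ⟨N, hN⟩ := exists_nat_ge ((A + 1) / δ)
  set n := N + 1 with hn
  have hAn : 1 - δ * n ≤ -A := by
    rw [div_le_iff₀ hδ0] at hN
    have : (n : ℝ) = N + 1 := by rw [hn]; push_cast; ring
    rw [this]
    nlinarith
  obtain ⟨R, hR⟩ := exists_polynomial_sqrt_approx N
  set d : ℝ := ((n * R.natDegree : ℕ) : ℝ) with hd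
  have hd0 : 0 ≤ d := Nat.cast_nonneg _
  set C1 : ℝ := 5 * 2 ^ n * (2 * n + 2) * |D (2 * n)| with hC1
  set C2 : ℝ := (2 * d + 1) * |D 0| * (2 * d) ^ A with hC2
  have hC1' : 0 ≤ C1 := by positivity
  have hC2' : 0 ≤ C2 := by positivity
  refine ⟨C1 + C2 + 1, by positivity, ?_⟩
  intro K hK W hsm hW hD x hx hxK
  have hK0 : 0 < K := by linarith
  have hKA : 0 < K ^ (-A) := Real.rpow_pos_of_pos hK0 _
  rw [norm_tsum_odd_eq hK0 hW]
  rcases lt_or_ge d (K / 2) with hlarge | hsmall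
  · have hmain := abs_sum_mul_besselJ_le (Nat.succ_ne_zero N) R hR hK hlarge hsm hW
      (fun y => (hD _ y).trans (le_abs_self _)) hx.le
    refine hmain.trans ?_
    have hx2 : x ≤ K ^ (2 - δ) := by
      rcases le_total ε 2 with h | h
      · rwa [hδ, min_eq_left h]
      · rw [hδ, min_eq_right h]
        exact hxK.trans (Real.rpow_le_rpow_of_exponent_le (by linarith) (by linarith))
    have h1 : 1 ≤ K ^ (2 - δ) := Real.one_le_rpow (by linarith) (by linarith)
    have h2 : (1 + x) ^ n ≤ 2 ^ n * K ^ ((2 - δ) * n) := by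
      rw [Real.rpow_mul_natCast hK0.le, ← mul_pow]
      gcongr
      linarith
    have h3 : K ^ ((2 - δ) * n) * (K * (1 / K) ^ (2 * n)) = K ^ (1 - δ * n) := by
      have e1 : (1 / K) ^ (2 * n) = K ^ (-(2 * n : ℝ)) := by
        rw [Real.rpow_neg hK0.le, one_div, inv_pow]
        congr 1
        exact_mod_cast (Real.rpow_natCast K (2 * n)).symm
      nth_rewrite 2 [← Real.rpow_one K]
      rw [e1, ← Real.rpow_add hK0, ← Real.rpow_add hK0]
      congr 1
      ring
    have h4 : K ^ (1 - δ * n) ≤ K ^ (-A) :=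
      Real.rpow_le_rpow_of_exponent_le (by linarith) hAn
    calc _ ≤ 5 * (2 ^ n * K ^ ((2 - δ) * n)) *
          ((2 * n + 2) * K * ((1 / K) ^ (2 * n) * |D (2 * n)|)) := by gcongr
      _ = C1 * (K ^ ((2 - δ) * n) * (K * (1 / K) ^ (2 * n))) := by rw [hC1]; ring
      _ ≤ C1 * K ^ (-A) := by rw [h3]; gcongr
      _ ≤ _ := by gcongr; linarith
  · have hKd : K ≤ 2 * d := by linarith
    have h1 : |∑ m ∈ Finset.range (⌊K⌋₊ + 1), W (2 / K * m) * ((-1) ^ m * besselJ (2 * m) x)| ≤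
        (2 * d + 1) * |D 0| := by
      refine (Finset.abs_sum_le_sum_abs _ _).trans ?_
      have h2 := Finset.sum_le_card_nsmul (Finset.range (⌊K⌋₊ + 1))
        (fun m : ℕ => |W (2 / K * m) * ((-1) ^ m * besselJ (2 * m) x)|) |D 0| (fun m _ => by
          have h3 : |W (2 / K * m)| ≤ |D 0| := by
            simpa using (hD 0 (2 / K * m)).trans (le_abs_self _)
          rw [abs_mul]
          simpa using mul_le_mul h3 (abs_neg_one_pow_mul_besselJ_two_mul_le m x)
            (abs_nonneg _) (abs_nonneg _))
      rw [Finset.card_range, nsmul_eq_mul] at h2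
      refine h2.trans ?_
      push_cast
      have := Nat.floor_le hK0.le
      gcongr
      linarith
    have h2 : 1 ≤ (2 * d) ^ A * K ^ (-A) := by
      have hKA' : 0 < K ^ A := Real.rpow_pos_of_pos hK0 _
      rw [Real.rpow_neg hK0.le, ← div_eq_mul_inv, one_le_div hKA']
      exact Real.rpow_le_rpow hK0.le hKd (by linarith)
    calc _ ≤ (2 * d + 1) * |D 0| * 1 := by rw [mul_one]; exact h1
      _ ≤ (2 * d + 1) * |D 0| * ((2 * d) ^ A * K ^ (-A)) := by gcongr
      _ = C2 * K ^ (-A) := by rw [hC2]; ring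
      _ ≤ _ := by gcongr; linarith
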